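/- Let φ ∈ C^∞ and let Π be the L^2-orthogonal projection onto polynomials of degree ≤ k on a shape-regular simplex T of diameter h_T with facet F ⊆ ∂T. Then for every polynomial v of degree ≤ k on T, ‖Π(φ v) - φ v‖_{L^2(F)} ≤ C h_T^{1/2} ‖φ‖_{W^{k+1,∞}(T)} ‖v‖_{L^2(T)}, with C depending only on k and the shape-regularity constant. -/

import Mathlib

open MeasureTheory MvPolynomial

/-- An affine change of variables `x ↦ z + h • x` does not raise the total degree. -/
theorem totalDegree_aeval_affine_le {σ : Type*} (z : σ → ℝ) (h : ℝ) (p : MvPolynomial σ ℝ) :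
    (aeval (fun i => C (z i) + C h * X i : σ → MvPolynomial σ ℝ) p).totalDegree ≤
      p.totalDegree := by
  rw [aeval_def, eval₂_eq]
  refine (totalDegree_finsetSum _ _).trans (Finset.sup_le fun d hd => ?_)
  refine le_trans ?_ (le_totalDegree hd)
  refine (totalDegree_mul _ _).trans ?_
  rw [algebraMap_eq, totalDegree_C, zero_add]
  refine (totalDegree_finsetProd _ _).trans (Finset.sum_le_sum fun i _ => ?_)
  refine (totalDegree_pow _ _).trans ?_
  have hlin : (C (z i) + C h * X i : MvPolynomial σ ℝ).totalDegree ≤ 1 := by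
    refine (totalDegree_add _ _).trans (max_le (by simp) ?_)
    refine (totalDegree_mul _ _).trans ?_
    simp
  simpa using Nat.mul_le_mul_left (d i) hlin

theorem eval_aeval_affine {σ : Type*} (z : σ → ℝ) (h : ℝ) (p : MvPolynomial σ ℝ) (y : σ → ℝ) :
    eval y (aeval (fun i => C (z i) + C h * X i : σ → MvPolynomial σ ℝ) p) =
      eval (z + h • y) p := by
  induction p using MvPolynomial.induction_on with
  | C a => simp
  | add p q hp hq => simp only [map_add, hp, hq]
  | mul_X p i hp => rw [map_mul, map_mul, hp]; simp

/-- A real polynomial whose square integrates to zero over a ball vanishes. -/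
theorem eq_zero_of_setIntegral_sq_eq_zero {σ : Type*} [Fintype σ] {δ : ℝ} (hδ : 0 < δ)
    (p : MvPolynomial σ ℝ) (hp : ∫ x in Metric.closedBall (0 : σ → ℝ) δ, (eval x p) ^ 2 = 0) :
    p = 0 := by
  have hc : Continuous fun x : σ → ℝ => (eval x p) ^ 2 := (continuous_eval p).pow 2
  have hi : IntegrableOn (fun x : σ → ℝ => (eval x p) ^ 2) (Metric.closedBall 0 δ) :=
    hc.continuousOn.integrableOn_compact (isCompact_closedBall _ _)
  rw [setIntegral_eq_zero_iff_of_nonneg_ae (.of_forall fun x => sq_nonneg _) hi] at hp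
  have hp' := ae_restrict_of_ae_restrict_of_subset Metric.ball_subset_closedBall hp
  have heq := Measure.eqOn_open_of_ae_eq hp' Metric.isOpen_ball hc.continuousOn
    continuousOn_const
  refine funext_set (fun _ => Metric.ball (0 : ℝ) δ) (fun i => ?_) fun x hx => ?_
  · rw [Real.ball_eq_Ioo]
    exact Set.Ioo_infinite (by linarith)
  · have : x ∈ Metric.ball (0 : σ → ℝ) δ := by
      rw [ball_pi _ hδ]; exact hx
    simpa using heq this

/-- On the unit ball, polynomials of bounded degree are controlled by their `L²` norm on any
smaller concentric ball. -/
theorem exists_sq_eval_le_setIntegral_sq {σ : Type*} [Fintype σ] (k : ℕ) {δ : ℝ} (hδ : 0 < δ) :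
    ∃ K > 0, ∀ p : MvPolynomial σ ℝ, p.totalDegree ≤ k →
      ∀ y ∈ Metric.closedBall (0 : σ → ℝ) 1,
        (eval y p) ^ 2 ≤ K * ∫ x in Metric.closedBall (0 : σ → ℝ) δ, (eval x p) ^ 2 := by
  let b := Module.finBasis ℝ (restrictTotalDegree σ ℝ k)
  set n := Module.finrank ℝ (restrictTotalDegree σ ℝ k)
  let q : (Fin n → ℝ) → MvPolynomial σ ℝ := fun a => ∑ i, a i • (b i : MvPolynomial σ ℝ)
  have hqeval (a : Fin n → ℝ) (y : σ → ℝ) :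
      eval y (q a) = ∑ i, a i * eval y (b i : MvPolynomial σ ℝ) := by
    simp [q, smul_eval]
  have hqc : Continuous
      (Function.uncurry fun (a : Fin n → ℝ) (y : σ → ℝ) => (eval y (q a)) ^ 2) := by
    simp only [hqeval, Function.uncurry_def]
    have (i : Fin n) : Continuous fun y : σ → ℝ => eval y (b i : MvPolynomial σ ℝ) :=
      continuous_eval _
    fun_prop
  let Q : (Fin n → ℝ) → ℝ := fun a => ∫ x in Metric.closedBall (0 : σ → ℝ) δ, (eval x (q a)) ^ 2
  have hQc : Continuous Q :=
    continuous_parametric_integral_of_continuous hqc (isCompact_closedBall _ _)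
  have hq0 (a : Fin n → ℝ) (ha : q a = 0) : a = 0 := by
    have h0 : ∑ i, a i • b i = 0 := by
      apply Subtype.ext
      simpa [q] using ha
    funext i
    exact Fintype.linearIndependent_iff.1 b.linearIndependent a h0 i
  have hQ0 (a : Fin n → ℝ) (ha : a ∈ Metric.sphere (0 : Fin n → ℝ) 1) : Q a ≠ 0 := by
    intro h
    have := hq0 a (eq_zero_of_setIntegral_sq_eq_zero hδ _ h)
    simp [this] at ha
  have hratio : ContinuousOn (fun w : (Fin n → ℝ) × (σ → ℝ) => (eval w.2 (q w.1)) ^ 2 / Q w.1)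
      (Metric.sphere 0 1 ×ˢ Metric.closedBall 0 1) :=
    hqc.continuousOn.div (hQc.comp continuous_fst).continuousOn fun w hw => hQ0 _ hw.1
  obtain ⟨K, hK⟩ := ((isCompact_sphere _ _).prod
    (isCompact_closedBall _ _)).exists_bound_of_continuousOn hratio
  refine ⟨max K 1, by positivity, fun p hp y hy => ?_⟩
  have hQnn (a : Fin n → ℝ) : 0 ≤ Q a := integral_nonneg fun x => sq_nonneg _
  obtain ⟨a, rfl⟩ : ∃ a, p = q a := by
    refine ⟨b.repr ⟨p, (mem_restrictTotalDegree _ _ _).2 hp⟩, ?_⟩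
    have := congrArg (restrictTotalDegree σ ℝ k).subtype
      (b.sum_repr ⟨p, (mem_restrictTotalDegree _ _ _).2 hp⟩)
    rw [map_sum] at this
    exact this.symm
  rcases eq_or_ne a 0 with rfl | ha
  · simp [hqeval]
  have hna : 0 < ‖a‖ := norm_pos_iff.2 ha
  set c := ‖a‖⁻¹ • a with hcdef
  have hac : a = ‖a‖ • c := by rw [hcdef, smul_inv_smul₀ hna.ne']
  have hcs : c ∈ Metric.sphere (0 : Fin n → ℝ) 1 := by
    simp [c, norm_smul, hna.ne']
  have hscale (x : σ → ℝ) : (eval x (q a)) ^ 2 = ‖a‖ ^ 2 * (eval x (q c)) ^ 2 := by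
    rw [← mul_pow]
    congr 1
    rw [hqeval, hqeval, Finset.mul_sum]
    refine Finset.sum_congr rfl fun i _ => ?_
    conv_lhs => rw [hac]
    simp only [Pi.smul_apply, smul_eq_mul]
    ring
  have h1 := hK (c, y) ⟨hcs, hy⟩
  have hQc0 : 0 < Q c := lt_of_le_of_ne (hQnn c) (hQ0 c hcs).symm
  have h2 : (eval y (q c)) ^ 2 ≤ K * Q c := (div_le_iff₀ hQc0).1 ((le_abs_self _).trans h1)
  have h3 : (eval y (q c)) ^ 2 ≤ max K 1 * Q c :=
    h2.trans (mul_le_mul_of_nonneg_right (le_max_left _ _) hQc0.le)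
  simp only [hscale, integral_const_mul]
  calc _ ≤ ‖a‖ ^ 2 * (max K 1 * Q c) := by gcongr
    _ = _ := by simp only [Q]; ring

/-- Scaled inverse inequality on the cube of radius `h` around `z`. -/
theorem exists_sq_eval_le_setIntegral_sq_scaled {σ : Type*} [Fintype σ] (k : ℕ) {δ : ℝ}
    (hδ : 0 < δ) :
    ∃ K > 0, ∀ (z : σ → ℝ) (h : ℝ), 0 < h → ∀ p : MvPolynomial σ ℝ, p.totalDegree ≤ k →
      ∀ x ∈ Metric.closedBall z h, (eval x p) ^ 2 ≤
        K * (h ^ Fintype.card σ)⁻¹ * ∫ x in Metric.closedBall z (δ * h), (eval x p) ^ 2 := by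
  obtain ⟨K, hK0, hK⟩ := exists_sq_eval_le_setIntegral_sq (σ := σ) k hδ
  refine ⟨K, hK0, fun z h hh p hp x hx => ?_⟩
  have hxy : z + h • (h⁻¹ • (x - z)) = x := by rw [smul_inv_smul₀ hh.ne']; abel
  have hy : h⁻¹ • (x - z) ∈ Metric.closedBall (0 : σ → ℝ) 1 := by
    rw [mem_closedBall_zero_iff, norm_smul, norm_inv, Real.norm_of_nonneg hh.le,
      inv_mul_le_one₀ hh, ← dist_eq_norm]
    exact hx
  have key := hK _ ((totalDegree_aeval_affine_le z h p).trans hp) _ hy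
  simp only [eval_aeval_affine, hxy] at key
  have hint : ∫ y in Metric.closedBall (0 : σ → ℝ) δ, (eval (z + h • y) p) ^ 2 =
      (h ^ Fintype.card σ)⁻¹ * ∫ x in Metric.closedBall z (δ * h), (eval x p) ^ 2 := by
    rw [Measure.setIntegral_comp_smul_of_pos volume (fun w => (eval (z + w) p) ^ 2) _ hh,
      smul_closedBall _ _ hδ.le, smul_zero, Module.finrank_fintype_fun_eq_card, smul_eq_mul,
      Real.norm_of_nonneg hh.le]
    congr 1
    have := (measurePreserving_add_left (volume : Measure (σ → ℝ)) z).setIntegral_preimage_emb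
      (measurableEmbedding_addLeft z) (fun x => (eval x p) ^ 2) (Metric.closedBall z (δ * h))
    rw [← this, preimage_add_closedBall, sub_self, mul_comm]
  rw [hint] at key
  rwa [mul_assoc]

/-- A triangle of diameter at most `h` has surface measure at most `4 h²`. -/
theorem hausdorffMeasure_two_triangle_le (p : Fin 3 → Fin 3 → ℝ) {h : ℝ} (hh : 0 ≤ h)
    (hp : ∀ i j, dist (p i) (p j) ≤ h) :
    μH[2] (convexHull ℝ (Set.range p)) ≤ ENNReal.ofReal (4 * h ^ 2) := by
  let f : (Fin 2 → ℝ) → (Fin 3 → ℝ) := fun s => p 0 + (s 0 • (p 1 - p 0) + s 1 • (p 2 - p 0))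
  have hsub : convexHull ℝ (Set.range p) ⊆ f '' Set.Icc 0 1 := by
    refine convexHull_min ?_ ?_
    · rintro _ ⟨i, rfl⟩
      fin_cases i
      · exact ⟨0, by simp, by simp [f]⟩
      · exact ⟨Pi.single 0 1, by simp [Pi.le_def, Fin.forall_fin_two], by simp [f]⟩
      · exact ⟨Pi.single 1 1, by simp [Pi.le_def, Fin.forall_fin_two], by simp [f]⟩
    · rintro _ ⟨s, hs, rfl⟩ _ ⟨t, ht, rfl⟩ a b ha hb hab
      refine ⟨a • s + b • t, convex_Icc 0 1 hs ht ha hb hab, ?_⟩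
      obtain rfl : b = 1 - a := by linarith
      simp only [f, Pi.add_apply, Pi.smul_apply, smul_eq_mul]
      module
  have hf : LipschitzWith (2 * h.toNNReal) f := by
    refine LipschitzWith.of_dist_le_mul fun s t => ?_
    have e : f s - f t = (s 0 - t 0) • (p 1 - p 0) + (s 1 - t 1) • (p 2 - p 0) := by
      simp only [f]; module
    have hst (i : Fin 2) : ‖s i - t i‖ ≤ ‖s - t‖ := norm_le_pi_norm (s - t) i
    have hpp (i : Fin 3) : ‖p i - p 0‖ ≤ h := by rw [← dist_eq_norm]; exact hp _ _
    rw [dist_eq_norm, dist_eq_norm, e]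
    push_cast
    rw [Real.coe_toNNReal _ hh]
    refine (norm_add_le _ _).trans ?_
    rw [norm_smul, norm_smul]
    have h1 := mul_le_mul (hst 0) (hpp 1) (norm_nonneg _) (norm_nonneg _)
    have h2 := mul_le_mul (hst 1) (hpp 2) (norm_nonneg _) (norm_nonneg _)
    linarith
  have hvol : μH[2] (Set.Icc (0 : Fin 2 → ℝ) 1) = 1 := by
    have := congrArg (fun μ => μ (Set.Icc (0 : Fin 2 → ℝ) 1))
      (hausdorffMeasure_pi_real (ι := Fin 2))
    simpa [Real.volume_Icc_pi] using this
  calc μH[2] (convexHull ℝ (Set.range p)) ≤ μH[2] (f '' Set.Icc 0 1) := measure_mono hsub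
    _ ≤ _ := hf.hausdorffMeasure_image_le zero_le_two _
    _ = _ := by
      rw [hvol, mul_one, ENNReal.rpow_two, ← ENNReal.ofReal_coe_nnreal,
        ← ENNReal.ofReal_pow (by positivity)]
      congr 1
      push_cast
      rw [Real.coe_toNNReal _ hh]
      ring

/-- The `L²` norm of a projection does not exceed that of the projected function. -/
theorem setIntegral_sq_le_of_orthogonal {α : Type*} [MeasurableSpace α] {μ : Measure α}
    {f g : α → ℝ} (hf : Integrable (fun x => f x ^ 2) μ) (hg : Integrable (fun x => g x ^ 2) μ)
    (hfg : Integrable (fun x => g x * f x) μ) (h : ∫ x, (f x - g x) * f x ∂μ = 0) :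
    ∫ x, f x ^ 2 ∂μ ≤ ∫ x, g x ^ 2 ∂μ := by
  have h1 : ∫ x, (f x - g x) * f x ∂μ = ∫ x, f x ^ 2 ∂μ - ∫ x, g x * f x ∂μ := by
    rw [← integral_sub hf hfg]
    congr 1 with x
    ring
  have h2 : 0 ≤ ∫ x, (f x - g x) ^ 2 ∂μ := integral_nonneg fun x => sq_nonneg _
  have h3 : ∫ x, (f x - g x) ^ 2 ∂μ =
      ∫ x, g x ^ 2 ∂μ - ∫ x, g x * f x ∂μ + ∫ x, (f x - g x) * f x ∂μ := by
    have hi : Integrable (fun x => (f x - g x) * f x) μ := by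
      refine (hf.sub hfg).congr (.of_forall fun x => ?_)
      simp only [Pi.sub_apply]
      ring
    have hs : Integrable (fun x => g x ^ 2 - g x * f x) μ := hg.sub hfg
    rw [← integral_sub hg hfg, ← integral_add hs hi]
    congr 1 with x
    ring
  linarith


/-- facet superconvergence of the `L²` projection onto polynomials of
degree `≤ k` on a shape-regular simplex `T` of diameter `h_T` with facet `F ⊆ ∂T`:
`‖Π(φv) - φv‖_{L²(F)} ≤ C h_T^{1/2} ‖φ‖_{W^{k+1,∞}(T)} ‖v‖_{L²(T)}`, with `C` depending
only on `k` and the shape-regularity constant `ρ`. The `L²(F)` norm is taken with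
respect to the two-dimensional Hausdorff (surface) measure, `Π(φv)` is characterized by
the orthogonality conditions, and `Mφ` is any bound on the derivatives of `φ` on `T` up
to order `k+1`. -/
theorem stmt_13 (k : ℕ) (ρ : ℝ) (hρ : 0 < ρ) :
    ∃ C > 0, ∀ (T F : Set (Fin 3 → ℝ)),
      (∃ pts : Fin 4 → (Fin 3 → ℝ), AffineIndependent ℝ pts ∧
        T = convexHull ℝ (Set.range pts) ∧
        ∃ j : Fin 4, F = convexHull ℝ (pts '' {i | i ≠ j})) →
      (∃ z r, ρ * Metric.diam T ≤ r ∧ Metric.ball z r ⊆ T) →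
      ∀ φ : (Fin 3 → ℝ) → ℝ, ContDiff ℝ (⊤ : ℕ∞) φ →
      ∀ Mφ : ℝ, (∀ x ∈ T, ∀ m ≤ k + 1, ‖iteratedFDeriv ℝ m φ x‖ ≤ Mφ) →
      ∀ v Pproj : MvPolynomial (Fin 3) ℝ,
        v.totalDegree ≤ k → Pproj.totalDegree ≤ k →
        (∀ q : MvPolynomial (Fin 3) ℝ, q.totalDegree ≤ k →
          ∫ x in T, (eval x Pproj - φ x * eval x v) * eval x q = 0) →
        Real.sqrt (∫ x in F, (eval x Pproj - φ x * eval x v) ^ 2 ∂(μH[2])) ≤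
          C * Real.sqrt (Metric.diam T) * Mφ * Real.sqrt (∫ x in T, (eval x v) ^ 2) := by
  obtain ⟨K, hK0, hK⟩ := exists_sq_eval_le_setIntegral_sq_scaled (σ := Fin 3) k (half_pos hρ)
  refine ⟨4 * √K, by positivity, ?_⟩
  rintro T F ⟨pts, hpts, rfl, j, rfl⟩ ⟨z, r, hr, hball⟩ φ hφ M hM v P hv hP horth
  set T := convexHull ℝ (Set.range pts)
  set h := Metric.diam T
  have hTc : IsCompact T := (Set.finite_range pts).isCompact_convexHull (𝕜 := ℝ)
  have hTconv : Convex ℝ T := convex_convexHull ℝ _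
  have hmem (i : Fin 4) : pts i ∈ T := subset_convexHull ℝ _ ⟨i, rfl⟩
  have hdist {x y : Fin 3 → ℝ} (hx : x ∈ T) (hy : y ∈ T) : dist x y ≤ h :=
    Metric.dist_le_diam_of_mem hTc.isBounded hx hy
  have hpos : 0 < h :=
    (dist_pos.2 (hpts.injective.ne (show (0 : Fin 4) ≠ 1 by decide))).trans_le
      (hdist (hmem 0) (hmem 1))
  have hzT : z ∈ T := hball (Metric.mem_ball_self ((mul_pos hρ hpos).trans_le hr))
  have hM0 : 0 ≤ M := (norm_nonneg _).trans (hM z hzT 0 (Nat.zero_le _))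
  have hφT {x : Fin 3 → ℝ} (hx : x ∈ T) : (φ x - φ z) ^ 2 ≤ (M * h) ^ 2 := by
    have hd := hTconv.norm_image_sub_le_of_norm_fderiv_le (𝕜 := ℝ) (f := φ) (C := M)
      (fun y _ => hφ.differentiable (by simp) y)
      (fun y hy => by
        rw [← norm_iteratedFDeriv_one (𝕜 := ℝ)]
        exact hM y hy 1 (by omega)) hzT hx
    rw [← sq_abs, ← Real.norm_eq_abs]
    gcongr
    refine hd.trans ?_
    gcongr
    rw [← dist_eq_norm]
    exact hdist hx hzT
  have hint {f : (Fin 3 → ℝ) → ℝ} (hf : Continuous f) : IntegrableOn f T :=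
    hf.continuousOn.integrableOn_compact hTc
  have hinv (p : MvPolynomial (Fin 3) ℝ) (hp : p.totalDegree ≤ k) {x : Fin 3 → ℝ} (hx : x ∈ T) :
      (eval x p) ^ 2 ≤ K * (h ^ 3)⁻¹ * ∫ x in T, (eval x p) ^ 2 := by
    refine (hK z h hpos p hp x (hdist hx hzT)).trans ?_
    rw [Fintype.card_fin]
    gcongr
    · exact .of_forall fun x => sq_nonneg _
    · exact hint ((continuous_eval p).pow 2)
    · refine (Metric.closedBall_subset_ball ?_).trans hball
      have := mul_pos hρ hpos
      linarith
  set V := ∫ x in T, (eval x v) ^ 2 with hV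
  have hV0 : 0 ≤ V := integral_nonneg fun x => sq_nonneg _
  let R : MvPolynomial (Fin 3) ℝ := P - C (φ z) * v
  have hR : R.totalDegree ≤ k := by
    refine (totalDegree_sub _ _).trans (max_le hP ((totalDegree_mul _ _).trans ?_))
    simpa using hv
  have hReval (x : Fin 3 → ℝ) : eval x R = eval x P - φ z * eval x v := by simp [R]
  have herr (x : Fin 3 → ℝ) :
      eval x P - φ x * eval x v = eval x R - (φ x - φ z) * eval x v := by
    rw [hReval]; ring
  have hcg : Continuous fun x => (φ x - φ z) * eval x v :=
    (hφ.continuous.sub continuous_const).mul (continuous_eval v)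
  have hRV : ∫ x in T, (eval x R) ^ 2 ≤ (M * h) ^ 2 * V := by
    have horthR := horth R hR
    simp only [herr] at horthR
    refine (setIntegral_sq_le_of_orthogonal (hint ((continuous_eval R).pow 2))
      (hint (hcg.pow 2)) (hint (hcg.mul (continuous_eval R))) horthR).trans ?_
    rw [hV, ← integral_const_mul]
    refine setIntegral_mono_on (hint (hcg.pow 2))
      (hint (continuous_const.mul ((continuous_eval v).pow 2))) hTc.measurableSet fun x hx => ?_
    rw [mul_pow]
    exact mul_le_mul_of_nonneg_right (hφT hx) (sq_nonneg _)
  have hsup {x : Fin 3 → ℝ} (hx : x ∈ T) :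
      (eval x P - φ x * eval x v) ^ 2 ≤ 4 * K * (h ^ 3)⁻¹ * ((M * h) ^ 2 * V) := by
    have h1 : (eval x R) ^ 2 ≤ K * (h ^ 3)⁻¹ * ((M * h) ^ 2 * V) :=
      (hinv R hR hx).trans (by gcongr)
    have h2 : ((φ x - φ z) * eval x v) ^ 2 ≤ (M * h) ^ 2 * (K * (h ^ 3)⁻¹ * V) := by
      rw [mul_pow]
      exact mul_le_mul (hφT hx) (hinv v hv hx) (sq_nonneg _) (sq_nonneg _)
    rw [herr]
    have h3 := sq_nonneg (eval x R + (φ x - φ z) * eval x v)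
    linarith
  have hFrange : pts '' {i | i ≠ j} = Set.range (pts ∘ j.succAbove) := by
    rw [Set.range_comp, Fin.range_succAbove]
    rfl
  rw [hFrange]
  set F := convexHull ℝ (Set.range (pts ∘ j.succAbove))
  have hFT : F ⊆ T := convexHull_mono (Set.range_comp_subset_range _ _)
  have hFμ : μH[2] F ≤ ENNReal.ofReal (4 * h ^ 2) :=
    hausdorffMeasure_two_triangle_le _ hpos.le fun i l => hdist (hmem _) (hmem _)
  have hFreal : (μH[2] : Measure (Fin 3 → ℝ)).real F ≤ 4 * h ^ 2 :=
    ENNReal.toReal_le_of_le_ofReal (by positivity) hFμ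
  have hFint : ∫ x in F, (eval x P - φ x * eval x v) ^ 2 ∂μH[2] ≤
      4 * K * (h ^ 3)⁻¹ * ((M * h) ^ 2 * V) * (4 * h ^ 2) := by
    have hb := norm_setIntegral_le_of_norm_le_const (hFμ.trans_lt ENNReal.ofReal_lt_top)
      fun x hx => (Real.norm_of_nonneg (sq_nonneg _)).trans_le (hsup (hFT hx))
    exact (le_abs_self _).trans (hb.trans (mul_le_mul_of_nonneg_left hFreal (by positivity)))
  refine Real.sqrt_le_iff.2 ⟨by positivity, hFint.trans_eq ?_⟩
  simp only [mul_pow, Real.sq_sqrt hK0.le, Real.sq_sqrt hpos.le, Real.sq_sqrt hV0]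
  field_simp
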